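/- Let u ∈ C^1(Ω;ℝ^n), F ∈ C^1(ℝ^n;ℝ^n), and ψ ∈ C^1_c(Ω). Then for almost every a ∈ ℝ^n the function x ↦ j u^a(x)·∇ψ(x) is integrable on Ω, the function a ↦ det∇F(a)·(−∫_Ω j u^a(x)·∇ψ(x) dx) is integrable on ℝ^n, and the weak chain rule for smooth maps holds: ∫_Ω ψ(x) det∇F(u(x)) det∇u(x) dx = (1/ω_n) ∫_{ℝ^n} det∇F(a) ( −∫_Ω j u^a(x)·∇ψ(x) dx ) da. -/

import Mathlib

open MeasureTheory Metric Filter Topology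

noncomputable section

abbrev Euc (n : ℕ) := EuclideanSpace ℝ (Fin n)

/-- The Jacobian matrix `∇u(x)` of a map `u : ℝⁿ → ℝⁿ`, with entries `∂_j u_i (x)`. -/
def jacMat (n : ℕ) (u : Euc n → Euc n) (x : Euc n) : Matrix (Fin n) (Fin n) ℝ :=
  Matrix.of fun i j => fderiv ℝ u x (EuclideanSpace.single j 1) i

/-- The vector field `j u := (1/n) (cof ∇u)ᵀ u` (componentwise); note that
`(cof A)ᵀ = adjugate A`. -/
def jvec (n : ℕ) (u : Euc n → Euc n) (x : Euc n) : Fin n → ℝ :=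
  fun i => (n : ℝ)⁻¹ * Matrix.mulVec (Matrix.adjugate (jacMat n u x)) (fun j => u x j) i

/-- The pointwise pairing `j u (x) · ∇ψ(x)`. -/
def jPair (n : ℕ) (u : Euc n → Euc n) (ψ : Euc n → ℝ) (x : Euc n) : ℝ :=
  ∑ i, jvec n u x i * fderiv ℝ ψ x (EuclideanSpace.single i 1)

/-- `ψ ∈ C¹_c(Ω)`. -/
def Cc1 (n : ℕ) (Ω : Set (Euc n)) (ψ : Euc n → ℝ) : Prop :=
  ContDiff ℝ 1 ψ ∧ HasCompactSupport ψ ∧ tsupport ψ ⊆ Ω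

/-- The fractional Sobolev seminorm `[u]_{W^{s,p}(Ω)}`. -/
def sobSemi (n : ℕ) (s p : ℝ) (Ω : Set (Euc n)) {F : Type*} [NormedAddCommGroup F]
    (u : Euc n → F) : ℝ :=
  (∫ x in Ω, ∫ y in Ω, ‖u x - u y‖ ^ p / dist x y ^ ((n : ℝ) + s * p)) ^ (1 / p)

/-- The fractional Sobolev norm `‖u‖_{W^{s,p}(Ω)} = ‖u‖_{L^p(Ω)} + [u]_{W^{s,p}(Ω)}`. -/
def sobNorm (n : ℕ) (s p : ℝ) (Ω : Set (Euc n)) {F : Type*} [NormedAddCommGroup F]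
    (u : Euc n → F) : ℝ :=
  (∫ x in Ω, ‖u x‖ ^ p) ^ (1 / p) + sobSemi n s p Ω u

/-- Membership `u ∈ W^{s,p}(Ω; F)`: `u ∈ L^p(Ω)` and the double integral defining
`[u]_{W^{s,p}(Ω)}^p` is finite. -/
def MemWsp (n : ℕ) (s p : ℝ) (Ω : Set (Euc n)) {F : Type*} [NormedAddCommGroup F]
    (u : Euc n → F) : Prop :=
  AEStronglyMeasurable u (volume.restrict Ω) ∧
  Integrable (fun x => ‖u x‖ ^ p) (volume.restrict Ω) ∧
  Integrable (fun q : Euc n × Euc n => ‖u q.1 - u q.2‖ ^ p / dist q.1 q.2 ^ ((n : ℝ) + s * p))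
    ((volume.restrict Ω).prod (volume.restrict Ω))

/-- `Ω` has smooth boundary: it is a sublevel set of a smooth function whose
differential does not vanish on the boundary. -/
def SmoothBoundary (n : ℕ) (Ω : Set (Euc n)) : Prop :=
  ∃ f : Euc n → ℝ, ContDiff ℝ (⊤ : ℕ∞) f ∧ Ω = f ⁻¹' Set.Iio 0 ∧
    ∀ x ∈ frontier Ω, fderiv ℝ f x ≠ 0

/-- `u^a(x) = (u(x) - a)/|u(x) - a|`. -/
def proj (n : ℕ) (u : Euc n → Euc n) (a : Euc n) : Euc n → Euc n :=
  fun x => ‖u x - a‖⁻¹ • (u x - a)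

/-- The set of Hölder quotients of `u` on `Ω`. -/
def holderSet (n : ℕ) (α : ℝ) (Ω : Set (Euc n)) {F : Type*} [NormedAddCommGroup F]
    (u : Euc n → F) : Set ℝ :=
  {r | ∃ x ∈ Ω, ∃ y ∈ Ω, x ≠ y ∧ r = ‖u x - u y‖ / dist x y ^ α}

/-- The Hölder seminorm `[u]_{C^{0,α}(Ω)}`. -/
def holderSemi (n : ℕ) (α : ℝ) (Ω : Set (Euc n)) {F : Type*} [NormedAddCommGroup F]
    (u : Euc n → F) : ℝ :=
  sSup (holderSet n α Ω u)

/-- The Hölder norm `‖u‖_{C^{0,α}(Ω)} = sup_Ω ‖u‖ + [u]_{C^{0,α}(Ω)}`. -/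
def holderNorm (n : ℕ) (α : ℝ) (Ω : Set (Euc n)) {F : Type*} [NormedAddCommGroup F]
    (u : Euc n → F) : ℝ :=
  sSup {r | ∃ x ∈ Ω, r = ‖u x‖} + holderSemi n α Ω u

/-- the volume `ω_n` of the unit ball of `ℝⁿ`. -/
def ballVol (n : ℕ) : ℝ := (volume (ball (0 : Euc n) 1)).toReal

/-- `⟨Jv, ψ⟩ = J` for `v ∈ W^{(n-1)/n, n}(Ω; ℝⁿ)`: approximating sequences of maps which are
`C¹` up to the boundary exist, and for every such sequence the Jacobian integrals converge
to `J`. -/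
def JPairing (n : ℕ) (Ω : Set (Euc n)) (v : Euc n → Euc n) (ψ : Euc n → ℝ) (J : ℝ) : Prop :=
  (∃ vk : ℕ → Euc n → Euc n, (∀ k, ContDiffOn ℝ 1 (vk k) (closure Ω)) ∧
      Tendsto (fun k => sobNorm n (((n : ℝ) - 1) / n) n Ω (vk k - v)) atTop (𝓝 0) ∧
      Tendsto (fun k => ∫ x in Ω, (jacMat n (vk k) x).det * ψ x) atTop (𝓝 J)) ∧
  (∀ vk : ℕ → Euc n → Euc n, (∀ k, ContDiffOn ℝ 1 (vk k) (closure Ω)) →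
      Tendsto (fun k => sobNorm n (((n : ℝ) - 1) / n) n Ω (vk k - v)) atTop (𝓝 0) →
      Tendsto (fun k => ∫ x in Ω, (jacMat n (vk k) x).det * ψ x) atTop (𝓝 J))

/-- The set of values `⟨Jv, ψ⟩` over test functions `ψ ∈ C¹_c(Ω)` with `|ψ| ≤ 1`;
its supremum is the total variation `|Jv|_{TV}`. -/
def TVset (n : ℕ) (Ω : Set (Euc n)) (v : Euc n → Euc n) : Set ℝ :=
  {r | ∃ ψ : Euc n → ℝ, Cc1 n Ω ψ ∧ (∀ x, |ψ x| ≤ 1) ∧ JPairing n Ω v ψ r}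

/-- `⟨Jv, ψ⟩ = -∫_Ω j v · ∇ψ` for (pointwise defined) `v`. -/
def jpairOn (n : ℕ) (Ω : Set (Euc n)) (v : Euc n → Euc n) (ψ : Euc n → ℝ) : ℝ :=
  -∫ x in Ω, jPair n v ψ x

/-- The `W^{-1,1}(Ω)` distance between two functionals on test functions:
`sup { S ψ - T ψ : ψ ∈ C¹_c(Ω), Lip ψ ≤ 1 }`. -/
def Wm11dist (n : ℕ) (Ω : Set (Euc n)) (S T : (Euc n → ℝ) → ℝ) : ℝ :=
  sSup {r | ∃ ψ : Euc n → ℝ, Cc1 n Ω ψ ∧ LipschitzWith 1 ψ ∧ r = S ψ - T ψ}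

section Aux
open Polynomial in
lemma lagr_coeff (N k : ℕ) (δ : ℝ) (hδ : 0 < δ) : ∃ (s c : Fin (N+1) → ℝ),
    (∀ j, 0 < s j ∧ s j < δ) ∧ ∀ p : ℝ[X], p.natDegree ≤ N →
      p.coeff k = ∑ j, c j * p.eval (s j) := by
  have hpos : (0:ℝ) < (N:ℝ) + 2 := by positivity
  let s : Fin (N+1) → ℝ := fun j => δ * ((j:ℝ) + 1) / (N + 2)
  have hs : Function.Injective s := by
    intro i j hij
    simp only [s] at hij
    have h2 : δ * ((i:ℝ) + 1) = δ * ((j:ℝ)+1) := by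
      field_simp at hij; rw [hij]
    have h3 : (i:ℝ) + 1 = (j:ℝ)+1 := mul_left_cancel₀ hδ.ne' h2
    exact Fin.ext (by exact_mod_cast (by linarith : (i:ℝ) = (j:ℝ)))
  refine ⟨s, fun j => (Lagrange.basis Finset.univ s j).coeff k, ?_, ?_⟩
  · intro j
    refine ⟨by positivity, ?_⟩
    simp only [s]
    rw [div_lt_iff₀ hpos]
    have : (j:ℝ) < (N:ℝ) + 1 := by exact_mod_cast j.2
    nlinarith
  · intro p hp
    have h := Lagrange.eq_interpolate (s := Finset.univ) (v := s) (f := p) hs.injOn (by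
      refine lt_of_le_of_lt degree_le_natDegree ?_
      simp only [Finset.card_univ, Fintype.card_fin]
      exact_mod_cast Nat.lt_succ_of_le hp)
    conv_lhs => rw [h]
    rw [Lagrange.interpolate_apply, finsetSum_coeff]
    refine Finset.sum_congr rfl fun j _ => ?_
    rw [coeff_C_mul, mul_comm]

open Polynomial Matrix in
lemma eval_detXC {n : ℕ} (A B : Matrix (Fin n) (Fin n) ℝ) (t : ℝ) :
    (det ((X : ℝ[X]) • B.map C + A.map C)).eval t = det (A + t • B) := by
  rw [← coe_evalRingHom, RingHom.map_det]
  congr 1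
  ext i j
  simp only [Matrix.add_apply, Matrix.smul_apply, RingHom.mapMatrix_apply, Matrix.map_apply, coe_evalRingHom, eval_add, smul_eq_mul, eval_mul, eval_X, eval_C]
  ring

open Polynomial Matrix in
lemma coeff_one_detXC {n : ℕ} (A B : Matrix (Fin n) (Fin n) ℝ) :
    (det ((X : ℝ[X]) • B.map C + A.map C)).coeff 1 = trace (adjugate A * B) := by
  have hinv : ∀ A : Matrix (Fin n) (Fin n) ℝ, A.det ≠ 0 →
      (det ((X : ℝ[X]) • B.map C + A.map C)).coeff 1 = trace (adjugate A * B) := by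
    intro A hA
    have h1 : (X : ℝ[X]) • B.map C + A.map C = A.map C * (1 + (X:ℝ[X]) • (A⁻¹ * B).map C) := by
      rw [Matrix.mul_add, mul_one, Matrix.mul_smul, ← Matrix.map_mul, ← Matrix.mul_assoc,
        Matrix.mul_nonsing_inv _ (isUnit_iff_ne_zero.2 hA), one_mul, add_comm]
    rw [h1, det_mul]
    have h2 : det (A.map (C : ℝ →+* ℝ[X])) = C A.det := by
      rw [RingHom.map_det]; rfl
    rw [h2, coeff_C_mul, coeff_det_one_add_X_smul_one, Matrix.inv_def, Ring.inverse_eq_inv',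
      Matrix.smul_mul, trace_smul, smul_eq_mul, mul_inv_cancel_left₀ hA]
  obtain ⟨s, c, -, hc⟩ := lagr_coeff n 1 1 one_pos
  have hdeg : ∀ A : Matrix (Fin n) (Fin n) ℝ,
      (det ((X : ℝ[X]) • B.map C + A.map C)).natDegree ≤ n := fun A => by
    simpa using natDegree_det_X_add_C_le B A
  have hform : ∀ A : Matrix (Fin n) (Fin n) ℝ,
      (det ((X : ℝ[X]) • B.map C + A.map C)).coeff 1 = ∑ j, c j * det (A + s j • B) := by
    intro A
    rw [hc _ (hdeg A)]
    simp_rw [eval_detXC]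
  have hev : ∀ᶠ ε in 𝓝[≠] (0:ℝ), (A + ε • (1:Matrix (Fin n) (Fin n) ℝ)).det ≠ 0 := by
    have hp : det ((X : ℝ[X]) • (1 : Matrix (Fin n) (Fin n) ℝ).map C + A.map C) ≠ 0 := by
      intro h0
      have := coeff_det_X_add_C_card (1 : Matrix (Fin n) (Fin n) ℝ) A
      rw [h0] at this
      simp at this
    have := (Polynomial.rootSet_finite (det ((X : ℝ[X]) • (1 : Matrix (Fin n) (Fin n) ℝ).map C + A.map C)) ℝ)
    have h3 := (this.subset (Set.sdiff_subset (t := {0}))).isClosed.isOpen_compl.mem_nhds (x := (0:ℝ)) (by simp)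
    filter_upwards [mem_nhdsWithin_of_mem_nhds h3, self_mem_nhdsWithin] with ε h4 h5 h6
    apply h4
    refine ⟨?_, h5⟩
    rw [mem_rootSet]
    refine ⟨hp, ?_⟩
    rw [← h6, ← eval_detXC, coe_aeval_eq_eval]
  have hev2 : ∀ᶠ ε in 𝓝[≠] (0:ℝ), ∑ j, c j * det ((A + ε • (1:Matrix (Fin n) (Fin n) ℝ)) + s j • B) =
     trace (adjugate (A + ε • (1:Matrix (Fin n) (Fin n) ℝ)) * B) := by
    filter_upwards [hev] with ε hε
    rw [← hform, hinv _ hε]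
  rw [hform]
  have hL : Continuous fun ε : ℝ => ∑ j, c j * det ((A + ε • (1:Matrix (Fin n) (Fin n) ℝ)) + s j • B) := by
    refine continuous_finsetSum _ fun j _ => continuous_const.mul ?_
    refine Continuous.matrix_det ?_
    fun_prop
  have hR : Continuous fun ε : ℝ => trace (adjugate (A + ε • (1:Matrix (Fin n) (Fin n) ℝ)) * B) := by
    refine Continuous.matrix_trace ?_
    refine Continuous.matrix_mul (Continuous.matrix_adjugate ?_) continuous_const
    fun_prop
  have l1 := (hL.tendsto 0).mono_left (nhdsWithin_le_nhds (s := {0}ᶜ))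
  have l2 := (hR.tendsto 0).mono_left (nhdsWithin_le_nhds (s := {0}ᶜ))
  have := tendsto_nhds_unique (l1.congr' hev2) l2
  simpa using this

open Matrix in
lemma adj_proj {n : ℕ} (v : Fin n → ℝ) (hv : v ⬝ᵥ v = 1) :
    adjugate (1 - vecMulVec v v) *ᵥ v = v := by
  have h1 : ∀ t : ℝ, t ≠ 1 → adjugate (1 - t • vecMulVec v v) *ᵥ v = v := by
    intro t ht
    have hdet : (1 - t • vecMulVec v v).det = 1 - t := by
      have := det_one_add_replicateCol_mul_replicateRow (ι := Unit) (-(t • v)) v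
      rw [← Matrix.vecMulVec_eq] at this
      rw [sub_eq_add_neg, ← Matrix.smul_vecMulVec, ← Matrix.neg_vecMulVec, this]
      simp [hv, sub_eq_add_neg]
    have hmv : (1 - t • vecMulVec v v) *ᵥ v = (1 - t) • v := by
      rw [Matrix.sub_mulVec, Matrix.smul_mulVec, one_mulVec, vecMulVec_mulVec, hv]
      simp [sub_smul]
    have h2 : adjugate (1 - t • vecMulVec v v) *ᵥ ((1 - t • vecMulVec v v) *ᵥ v) = (1 - t) • v := by
      rw [mulVec_mulVec, adjugate_mul, hdet, Matrix.smul_mulVec, one_mulVec]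
    rw [hmv, mulVec_smul] at h2
    have h3 : (1 - t) ≠ 0 := sub_ne_zero.2 ht.symm
    exact smul_right_injective _ h3 h2
  have hL : Continuous fun t : ℝ => adjugate (1 - t • vecMulVec v v) *ᵥ v := by
    refine Continuous.matrix_mulVec (Continuous.matrix_adjugate ?_) continuous_const
    fun_prop
  have l1 := (hL.tendsto 1).mono_left (nhdsWithin_le_nhds (s := {1}ᶜ))
  have l2 : Tendsto (fun t : ℝ => adjugate (1 - t • vecMulVec v v) *ᵥ v) (𝓝[≠] 1) (𝓝 v) := by
    refine tendsto_const_nhds.congr' ?_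
    filter_upwards [self_mem_nhdsWithin] with t ht
    exact (h1 t ht).symm
  simpa using tendsto_nhds_unique l1 l2

lemma det_zero_fin {n : ℕ} (hn : n ≠ 0) : (0 : Matrix (Fin n) (Fin n) ℝ).det = 0 := by
  have : Nonempty (Fin n) := Fin.pos_iff_nonempty.1 (Nat.pos_of_ne_zero hn)
  exact Matrix.det_zero

lemma det_jacMat {n : ℕ} (u : Euc n → Euc n) (x : Euc n) :
    (jacMat n u x).det = (fderiv ℝ u x).det := by
  rw [ContinuousLinearMap.det, ← LinearMap.det_toMatrix (EuclideanSpace.basisFun (Fin n) ℝ).toBasis]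
  congr 1

lemma jacMat_continuous {n : ℕ} {u : Euc n → Euc n} (hu : ContDiff ℝ 1 u) :
    Continuous (jacMat n u) := by
  refine continuous_matrix fun i j => ?_
  have h := hu.continuous_fderiv one_ne_zero
  simp only [jacMat, Matrix.of_apply]
  fun_prop

lemma jacMat_add_smul {n : ℕ} {u v : Euc n → Euc n} {x : Euc n} (hu : DifferentiableAt ℝ u x)
    (hv : DifferentiableAt ℝ v x) (t : ℝ) :
    jacMat n (fun y => u y + t • v y) x = jacMat n u x + t • jacMat n v x := by
  ext i j
  simp only [jacMat, Matrix.of_apply, Matrix.add_apply, Matrix.smul_apply]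
  rw [fderiv_fun_add hu (hv.fun_const_smul t), fderiv_fun_const_smul hv]
  simp

lemma jacMat_id {n : ℕ} (x : Euc n) : jacMat n (fun y => y) x = 1 := by
  ext i j
  simp [jacMat, Matrix.one_apply]

open Polynomial in
lemma integral_coeff_zero {α : Type*} [MeasurableSpace α] (μ : Measure α) (p : α → ℝ[X]) (N k : ℕ)
    (hk : k ≠ 0) (hN : ∀ x, (p x).natDegree ≤ N) (hIntg : ∀ t, Integrable (fun x => (p x).eval t) μ)
    (δ : ℝ) (hδ : 0 < δ) (K : ℝ) (hK : ∀ t, 0 < t → t < δ → ∫ x, (p x).eval t ∂μ = K) :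
    ∫ x, (p x).coeff k ∂μ = 0 := by
  obtain ⟨s, c, hs, hc⟩ := lagr_coeff N k δ hδ
  have h1 : ∀ x, (p x).coeff k = ∑ j, c j * (p x).eval (s j) := fun x => hc _ (hN x)
  simp_rw [h1]
  rw [integral_finsetSum _ fun j _ => (hIntg _).const_mul _]
  simp_rw [integral_const_mul]
  have h2 : ∀ j, ∫ x, (p x).eval (s j) ∂μ = K := fun j => hK _ (hs j).1 (hs j).2
  simp_rw [h2]
  have h3 := hc (C K) (by simp)
  rw [coeff_C, if_neg hk] at h3
  simpa using h3.symm

/-- `∫ det ∇w = 0` for `w ∈ C¹_c`. -/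
lemma small_perturb {n : ℕ} {w : Euc n → Euc n} (hw : ContDiff ℝ 1 w)
    (hc : HasCompactSupport w) {R : ℝ} (hR : tsupport w ⊆ closedBall 0 R) :
    ∃ δ > (0:ℝ), ∀ t : ℝ, 0 < t → t < δ →
      ∫ x in closedBall (0 : Euc n) R, (1 + t • jacMat n w x).det = volume.real (closedBall (0 : Euc n) R) := by
  obtain ⟨C, hC⟩ := hw.lipschitzWith_of_hasCompactSupport hc one_ne_zero
  -- positivity of the determinant
  have hpos : ∃ δ > (0:ℝ), ∀ t : ℝ, 0 < t → t < δ → ∀ x, 0 < (1 + t • jacMat n w x).det := by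
    have hcont : Continuous fun q : ℝ × Euc n => (1 + q.1 • jacMat n w q.2).det := by
      have := jacMat_continuous hw
      refine Continuous.matrix_det ?_
      fun_prop
    have hK : ∀ᶠ t in 𝓝 (0:ℝ), ∀ x ∈ tsupport w, 0 < (1 + t • jacMat n w x).det := by
      refine hc.isCompact.eventually_forall_of_forall_eventually fun x _ => ?_
      have : Tendsto (fun q : ℝ × Euc n => (1 + q.1 • jacMat n w q.2).det) (𝓝 (0, x)) (𝓝 1) := by
        have := hcont.tendsto (0, x)
        simpa using this
      exact this.eventually (lt_mem_nhds one_pos)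
    obtain ⟨δ, hδ, h⟩ := Metric.eventually_nhds_iff.1 hK
    refine ⟨δ, hδ, fun t ht htδ x => ?_⟩
    by_cases hx : x ∈ tsupport w
    · exact h (by simpa [abs_of_pos ht] using htδ) x hx
    · have : jacMat n w x = 0 := by
        have : fderiv ℝ w x = 0 := by
          by_contra h0
          exact hx (support_fderiv_subset ℝ h0)
        ext i j
        simp [jacMat, this]
      simp [this]
  obtain ⟨δ, hδ, hpos⟩ := hpos
  refine ⟨min δ (1 / (C + 1)), by positivity, fun t ht htδ => ?_⟩
  have ht1 : t < δ := lt_of_lt_of_le htδ (min_le_left _ _)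
  have ht2 : t * C < 1 := by
    have h := lt_of_lt_of_le htδ (min_le_right _ _)
    have hC0 : (0:ℝ) ≤ C := C.2
    rw [lt_div_iff₀ (by positivity)] at h
    nlinarith
  set T : Euc n → Euc n := fun x => x + t • w x with hT
  have happ : ApproximatesLinearOn T ((ContinuousLinearEquiv.refl ℝ (Euc n)) : Euc n →L[ℝ] Euc n)
      Set.univ (t.toNNReal * C) := by
    intro x _ y _
    have : T x - T y - ((ContinuousLinearEquiv.refl ℝ (Euc n)) : Euc n →L[ℝ] Euc n) (x - y)
        = t • (w x - w y) := by
      simp [hT, smul_sub]; abel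
    rw [this, norm_smul, Real.norm_of_nonneg ht.le]
    have h := hC.dist_le_mul x y
    rw [dist_eq_norm, dist_eq_norm] at h
    calc t * ‖w x - w y‖ ≤ t * (C * ‖x - y‖) := by gcongr
      _ = _ := by simp [ht.le]; ring
  have hcond : Subsingleton (Euc n) ∨ t.toNNReal * C <
      ‖((ContinuousLinearEquiv.refl ℝ (Euc n)).symm : Euc n →L[ℝ] Euc n)‖₊⁻¹ := by
    rcases subsingleton_or_nontrivial (Euc n) with h | h
    · exact Or.inl h
    · right
      have : ‖((ContinuousLinearEquiv.refl ℝ (Euc n)).symm : Euc n →L[ℝ] Euc n)‖₊ = 1 := by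
        have : ((ContinuousLinearEquiv.refl ℝ (Euc n)).symm : Euc n →L[ℝ] Euc n)
          = ContinuousLinearMap.id ℝ (Euc n) := rfl
        rw [this]
        exact ContinuousLinearMap.nnnorm_id
      rw [this, inv_one, ← NNReal.coe_lt_coe]
      simpa [ht.le] using ht2
  have hsurj := happ.surjective hcond
  have hinj : Function.Injective T := Set.injOn_univ.1 (happ.injOn hcond)
  have hout : ∀ x, x ∉ closedBall (0: Euc n) R → T x = x := by
    intro x hx
    have : w x = 0 := image_eq_zero_of_notMem_tsupport fun h => hx (hR h)
    simp [hT, this]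
  have himg : T '' closedBall 0 R = closedBall 0 R := by
    ext y
    constructor
    · rintro ⟨x, hx, rfl⟩
      by_contra h
      have := hinj (hout _ h)
      rw [this] at h
      exact h hx
    · intro hy
      obtain ⟨x, rfl⟩ := hsurj y
      refine ⟨x, ?_, rfl⟩
      by_contra h
      rw [hout x h] at hy
      exact h hy
  have hdiff : Differentiable ℝ w := hw.differentiable one_ne_zero
  have hTd : ∀ x, HasFDerivAt T (fderiv ℝ T x) x := fun x => by
    apply DifferentiableAt.hasFDerivAt
    exact differentiableAt_id.add ((hdiff x).const_smul t)
  have hcov := integral_image_eq_integral_abs_det_fderiv_smul volume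
    (measurableSet_closedBall (x := (0:Euc n)) (ε := R))
    (fun x _ => (hTd x).hasFDerivWithinAt) hinj.injOn (fun _ => (1:ℝ))
  rw [himg] at hcov
  simp only [smul_eq_mul, mul_one, integral_const, measureReal_restrict_apply_univ] at hcov
  rw [hcov]
  refine setIntegral_congr_fun measurableSet_closedBall fun x _ => ?_
  have h5 : jacMat n T x = 1 + t • jacMat n w x := by
    rw [hT, jacMat_add_smul (u := fun y => y) differentiableAt_fun_id (hdiff x), jacMat_id x]
  rw [← det_jacMat, h5, abs_of_pos (hpos t ht ht1 x)]

open Polynomial Matrix in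
lemma integral_det_zero {n : ℕ} (hn : n ≠ 0) {w : Euc n → Euc n} (hw : ContDiff ℝ 1 w)
    (hc : HasCompactSupport w) : ∫ x, (jacMat n w x).det = 0 := by
  obtain ⟨R, hR⟩ := hc.isCompact.isBounded.subset_closedBall (0 : Euc n)
  obtain ⟨δ, hδ, h⟩ := small_perturb hw hc hR
  have hz : ∀ x, x ∉ closedBall (0: Euc n) R → (jacMat n w x).det = 0 := by
    intro x hx
    have : jacMat n w x = 0 := by
      have : fderiv ℝ w x = 0 := by
        by_contra h0
        exact hx (hR (support_fderiv_subset ℝ h0))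
      ext i j
      simp [jacMat, this]
    rw [this, det_zero_fin hn]
  rw [← setIntegral_eq_integral_of_forall_compl_eq_zero (s := closedBall 0 R) hz]
  have hcont := jacMat_continuous hw
  have key := integral_coeff_zero (volume.restrict (closedBall (0: Euc n) R))
    (fun x => det ((X : ℝ[X]) • (jacMat n w x).map C + (1 : Matrix (Fin n) (Fin n) ℝ).map C)) n n hn
    (fun x => by simpa using natDegree_det_X_add_C_le (jacMat n w x) 1)
    (fun t => by
      simp_rw [eval_detXC]
      refine ContinuousOn.integrableOn_compact (isCompact_closedBall _ _) ?_
      refine Continuous.continuousOn (Continuous.matrix_det ?_)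
      fun_prop) δ hδ (volume.real (closedBall (0 : Euc n) R)) (fun t h1 h2 => by
      simp_rw [eval_detXC]
      exact h t h1 h2)
  have h6 : ∀ x, (det ((X : ℝ[X]) • (jacMat n w x).map C + (1 : Matrix (Fin n) (Fin n) ℝ).map C)).coeff n
      = (jacMat n w x).det := fun x => by
    simpa using coeff_det_X_add_C_card (jacMat n w x) 1
  simp_rw [h6] at key
  exact key

lemma jacMat_eq_zero {n : ℕ} {w : Euc n → Euc n} {x : Euc n} (hx : x ∉ tsupport w) :
    jacMat n w x = 0 := by
  have : fderiv ℝ w x = 0 := by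
    by_contra h0
    exact hx (support_fderiv_subset ℝ h0)
  ext i j
  simp [jacMat, this]

open Polynomial Matrix in
lemma integral_trace_zero {n : ℕ} (hn : n ≠ 0) {u η : Euc n → Euc n} (hu : ContDiff ℝ 1 u)
    (huc : HasCompactSupport u) (hη : ContDiff ℝ 1 η) (hηc : HasCompactSupport η) :
    ∫ x, trace (adjugate (jacMat n u x) * jacMat n η x) = 0 := by
  have hcu := jacMat_continuous hu
  have hcη := jacMat_continuous hη
  have key := integral_coeff_zero (volume : Measure (Euc n))
    (fun x => det ((X : ℝ[X]) • (jacMat n η x).map C + (jacMat n u x).map C)) n 1 one_ne_zero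
    (fun x => by simpa using natDegree_det_X_add_C_le (jacMat n η x) (jacMat n u x))
    (fun t => by
      simp_rw [eval_detXC]
      refine Continuous.integrable_of_hasCompactSupport ?_ ?_
      · refine Continuous.matrix_det ?_
        fun_prop
      · refine HasCompactSupport.intro (huc.isCompact.union hηc.isCompact) fun x hx => ?_
        rw [Set.mem_union, not_or] at hx
        rw [jacMat_eq_zero hx.1, jacMat_eq_zero hx.2, smul_zero, add_zero,
          det_zero_fin hn])
      1 one_pos 0 (fun t h1 h2 => by
      simp_rw [eval_detXC]
      have h7 : ∀ x, jacMat n (fun y => u y + t • η y) x = jacMat n u x + t • jacMat n η x :=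
        fun x => jacMat_add_smul (hu.differentiable one_ne_zero x)
          (hη.differentiable one_ne_zero x) t
      simp_rw [← h7]
      refine integral_det_zero hn (hu.add (hη.const_smul t)) ?_
      exact huc.add (hηc.smul_left (f := fun _ => t)))
  simp_rw [coeff_one_detXC] at key
  exact key

/-- the gradient as a coordinate vector -/
def gradv (n : ℕ) (ψ : Euc n → ℝ) (x : Euc n) : Fin n → ℝ :=
  fun i => fderiv ℝ ψ x (EuclideanSpace.single i 1)

/-- the vector `(cof ∇u) ∇ψ` -/
def bvec (n : ℕ) (u : Euc n → Euc n) (ψ : Euc n → ℝ) (x : Euc n) : Euc n :=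
  WithLp.toLp 2 (Matrix.vecMul (gradv n ψ x) (Matrix.adjugate (jacMat n u x)))

open Matrix in
lemma inner_bvec {n : ℕ} (u : Euc n → Euc n) (ψ : Euc n → ℝ) (x y : Euc n) :
    inner ℝ (bvec n u ψ x) y =
      (Matrix.adjugate (jacMat n u x) *ᵥ (fun j => y j)) ⬝ᵥ gradv n ψ x := by
  rw [dotProduct_comm, dotProduct_mulVec, EuclideanSpace.inner_eq_star_dotProduct]
  simp only [bvec, star_trivial]
  rw [dotProduct_comm]

lemma jacMat_eq_toMatrix {n : ℕ} (u : Euc n → Euc n) (x : Euc n) :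
    jacMat n u x = LinearMap.toMatrix (EuclideanSpace.basisFun (Fin n) ℝ).toBasis
      (EuclideanSpace.basisFun (Fin n) ℝ).toBasis (fderiv ℝ u x : Euc n →ₗ[ℝ] Euc n) := by
  ext i j
  simp [jacMat, LinearMap.toMatrix_apply]

lemma jacMat_comp {n : ℕ} {V u : Euc n → Euc n} {x : Euc n} (hV : DifferentiableAt ℝ V (u x))
    (hu : DifferentiableAt ℝ u x) :
    jacMat n (fun y => V (u y)) x = jacMat n V (u x) * jacMat n u x := by
  rw [jacMat_eq_toMatrix, jacMat_eq_toMatrix, jacMat_eq_toMatrix, fderiv_fun_comp x hV hu,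
    ← LinearMap.toMatrix_comp]
  rfl

open Matrix in
lemma jacMat_smul {n : ℕ} {ψ : Euc n → ℝ} {W : Euc n → Euc n} {x : Euc n}
    (hψ : DifferentiableAt ℝ ψ x) (hW : DifferentiableAt ℝ W x) :
    jacMat n (fun y => ψ y • W y) x =
      vecMulVec (fun j => W x j) (gradv n ψ x) + ψ x • jacMat n W x := by
  ext i j
  simp only [jacMat, Matrix.of_apply, Matrix.add_apply, Matrix.smul_apply, vecMulVec_apply, gradv]
  rw [fderiv_fun_smul hψ hW]
  simp
  ring

lemma gradv_continuous {n : ℕ} {ψ : Euc n → ℝ} (hψ : ContDiff ℝ 1 ψ) : Continuous (gradv n ψ) := by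
  refine continuous_pi fun i => ?_
  have h := hψ.continuous_fderiv one_ne_zero
  simp only [gradv]
  fun_prop

lemma gradv_eq_zero {n : ℕ} {ψ : Euc n → ℝ} {x : Euc n} (hx : x ∉ tsupport ψ) :
    gradv n ψ x = 0 := by
  have : fderiv ℝ ψ x = 0 := by
    by_contra h0
    exact hx (support_fderiv_subset ℝ h0)
  ext i
  simp [gradv, this]

lemma bvec_continuous {n : ℕ} {u : Euc n → Euc n} (hu : ContDiff ℝ 1 u)
    {ψ : Euc n → ℝ} (hψ : ContDiff ℝ 1 ψ) : Continuous (bvec n u ψ) := by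
  have h1 := jacMat_continuous hu
  have h2 := gradv_continuous hψ
  refine (PiLp.continuous_toLp 2 _).comp ?_
  exact h2.matrix_vecMul h1.matrix_adjugate

lemma bvec_eq_zero {n : ℕ} {u : Euc n → Euc n} {ψ : Euc n → ℝ} {x : Euc n} (hx : x ∉ tsupport ψ) :
    bvec n u ψ x = 0 := by
  simp [bvec, gradv_eq_zero hx]

open Matrix in
lemma key_identity {n : ℕ} (hn : n ≠ 0) {u V : Euc n → Euc n} (hu : ContDiff ℝ 1 u)
    (huc : HasCompactSupport u) {ψ : Euc n → ℝ} (hψ : ContDiff ℝ 1 ψ) (hψc : HasCompactSupport ψ)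
    (hV : ContDiff ℝ 1 V) :
    ∫ x, inner ℝ (bvec n u ψ x) (V (u x)) =
      - ∫ x, ψ x * trace (jacMat n V (u x)) * (jacMat n u x).det := by
  have hη : ContDiff ℝ 1 (fun x => ψ x • V (u x)) := hψ.smul (hV.comp hu)
  have hηc : HasCompactSupport (fun x => ψ x • V (u x)) := hψc.smul_right
  have h := integral_trace_zero hn hu huc hη hηc
  have hpt : ∀ x, trace (adjugate (jacMat n u x) * jacMat n (fun x => ψ x • V (u x)) x) =
      inner ℝ (bvec n u ψ x) (V (u x)) + ψ x * trace (jacMat n V (u x)) * (jacMat n u x).det := by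
    intro x
    have hVd := hV.differentiable one_ne_zero (u x)
    have hud := hu.differentiable one_ne_zero x
    rw [jacMat_smul (hψ.differentiable one_ne_zero x) (hVd.fun_comp' x hud), jacMat_comp hVd hud,
      inner_bvec, Matrix.mul_add, trace_add, Matrix.mul_smul, trace_smul, mul_vecMulVec,
      trace_vecMulVec, Matrix.trace_mul_comm, Matrix.mul_assoc, mul_adjugate, Matrix.mul_smul,
      trace_smul, mul_one]
    simp only [smul_eq_mul]
    ring
  simp_rw [hpt] at h
  have hj := jacMat_continuous hu
  have hjV := jacMat_continuous hV
  have hi1 : Integrable (fun x => inner ℝ (bvec n u ψ x) (V (u x))) := by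
    refine Continuous.integrable_of_hasCompactSupport ?_ ?_
    · have h1 := bvec_continuous hu hψ
      have h2 := hV.continuous.comp hu.continuous
      exact h1.inner h2
    · refine HasCompactSupport.intro hψc fun x hx => ?_
      rw [bvec_eq_zero hx, inner_zero_left]
  have hi2 : Integrable (fun x => ψ x * trace (jacMat n V (u x)) * (jacMat n u x).det) := by
    refine Continuous.integrable_of_hasCompactSupport ?_ ?_
    · exact (hψ.continuous.mul (hjV.comp hu.continuous).matrix_trace).mul hj.matrix_det
    · refine HasCompactSupport.intro hψc fun x hx => ?_
      rw [image_eq_zero_of_notMem_tsupport hx, zero_mul, zero_mul]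
  rw [integral_add hi1 hi2] at h
  linarith

/-- the kernel `z / |z|^n` -/
def kerK (n : ℕ) (z : Euc n) : Euc n := (‖z‖ ^ n)⁻¹ • z

lemma kerK_measurable (n : ℕ) : Measurable (kerK n) := by
  unfold kerK
  fun_prop

lemma norm_ker (n : ℕ) (z : Euc n) : ‖kerK n z‖ = (‖z‖ ^ n)⁻¹ * ‖z‖ := by
  rw [kerK, norm_smul, norm_inv, norm_pow, norm_norm]

lemma kerK_integrableOn_ball {n : ℕ} (hn : n ≠ 0) (r : ℝ) : IntegrableOn (kerK n) (ball 0 r) := by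
  have : Nonempty (Fin n) := Fin.pos_iff_nonempty.1 (Nat.pos_of_ne_zero hn)
  have : Nontrivial (Euc n) := inferInstance
  rw [IntegrableOn, ← integrable_norm_iff (kerK_measurable n).aestronglyMeasurable]
  simp_rw [norm_ker]
  have := (integrableOn_fun_norm_addHaar (volume : Measure (Euc n)) (f := fun y : ℝ => (y ^ n)⁻¹ * y) (r := r)).2 ?_
  · exact this
  · have h1 : IntegrableOn (fun _ : ℝ => (1:ℝ)) (Set.Ioo 0 r) := by simp
    refine h1.congr_fun ?_ measurableSet_Ioo
    intro y hy
    have hy0 : y ≠ 0 := hy.1.ne'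
    obtain ⟨m, rfl⟩ := Nat.exists_eq_succ_of_ne_zero hn
    simp only [finrank_euclideanSpace, Fintype.card_fin, Nat.succ_eq_add_one, Nat.add_sub_cancel,
      smul_eq_mul]
    field_simp
    ring

lemma kerK_locallyIntegrable {n : ℕ} (hn : n ≠ 0) : LocallyIntegrable (kerK n) := by
  rw [locallyIntegrable_iff]
  intro k hk
  obtain ⟨r, hr⟩ := hk.isBounded.subset_ball (0 : Euc n)
  exact (kerK_integrableOn_ball hn r).mono_set hr

lemma jacMat_normalize {n : ℕ} {z : Euc n} (hz : z ≠ 0) :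
    jacMat n (fun y => ‖y‖⁻¹ • y) z =
      ‖z‖⁻¹ • (1 - Matrix.vecMulVec (fun j => (‖z‖⁻¹ • z) j) (fun j => (‖z‖⁻¹ • z) j)) := by
  have hz' : ‖z‖ ≠ 0 := norm_ne_zero_iff.2 hz
  have hnd : DifferentiableAt ℝ (fun y : Euc n => ‖y‖) z := (contDiffAt_norm ℝ hz).differentiableAt one_ne_zero
  have hfn : ∀ v, fderiv ℝ (fun y : Euc n => ‖y‖) z v = ‖z‖⁻¹ * inner ℝ z v := by
    intro v
    have h1 : HasFDerivAt (fun y : Euc n => ‖y‖ ^ 2) (2 • innerSL ℝ z) z :=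
      (hasStrictFDerivAt_norm_sq z).hasFDerivAt
    have h2 := (hnd.hasFDerivAt.pow 2).unique h1
    have h3 := congrArg (fun A => A v) h2
    simp at h3
    field_simp
    linarith
  have hid : DifferentiableAt ℝ (fun y : Euc n => ‖y‖⁻¹) z := hnd.inv hz'
  rw [jacMat_smul hid differentiableAt_fun_id, jacMat_id]
  ext i j
  have hg : gradv n (fun y : Euc n => ‖y‖⁻¹) z j = - (‖z‖ ^ 2)⁻¹ * (‖z‖⁻¹ * z j) := by
    simp only [gradv]
    have hc : HasFDerivAt (fun y : Euc n => ‖y‖⁻¹) _ z :=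
      (hasDerivAt_inv hz').comp_hasFDerivAt z hnd.hasFDerivAt
    rw [hc.fderiv]
    simp [hfn, EuclideanSpace.inner_single_right]
  simp only [Matrix.add_apply, Matrix.vecMulVec_apply, hg, Matrix.smul_apply, Matrix.sub_apply,
    PiLp.smul_apply, smul_eq_mul]
  field_simp
  ring

open Matrix in
lemma jPair_proj {n : ℕ} (hn : n ≠ 0) {u : Euc n → Euc n} {x : Euc n} (hu : DifferentiableAt ℝ u x)
    (ψ : Euc n → ℝ) (a : Euc n) :
    jPair n (proj n u a) ψ x = (n:ℝ)⁻¹ * inner ℝ (bvec n u ψ x) (kerK n (u x - a)) := by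
  have hL : jPair n (proj n u a) ψ x = (n:ℝ)⁻¹ *
      ((adjugate (jacMat n (proj n u a) x) *ᵥ (fun j => proj n u a x j)) ⬝ᵥ gradv n ψ x) := by
    simp only [jPair, jvec, dotProduct, gradv, Finset.mul_sum, mul_assoc]
  rw [hL, inner_bvec]
  by_cases hz : u x - a = 0
  · have h1 : (fun j => proj n u a x j) = 0 := by ext j; simp [proj, hz]
    have h2 : (fun j => kerK n (u x - a) j) = 0 := by ext j; simp [kerK, hz]
    rw [h1, h2, mulVec_zero, mulVec_zero]
  congr 2
  have hz' : ‖u x - a‖ ≠ 0 := norm_ne_zero_iff.2 hz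
  set z := u x - a with hzdef
  set v : Fin n → ℝ := fun j => (‖z‖⁻¹ • z) j with hv
  have hvv : v ⬝ᵥ v = 1 := by
    have : v ⬝ᵥ v = inner ℝ (‖z‖⁻¹ • z) (‖z‖⁻¹ • z) := by
      rw [EuclideanSpace.inner_eq_star_dotProduct]; rfl
    rw [this, real_inner_self_eq_norm_sq, norm_smul, norm_inv, norm_norm, inv_mul_cancel₀ hz', one_pow]
  have hu' : jacMat n (fun y => u y - a) x = jacMat n u x := by
    ext i j
    simp only [jacMat, fderiv_sub_const]
  have hj : jacMat n (proj n u a) x = (‖z‖⁻¹ • (1 - vecMulVec v v)) * jacMat n u x := by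
    have hd : DifferentiableAt ℝ (fun y : Euc n => ‖y‖⁻¹ • y) z := by
      have hnd : DifferentiableAt ℝ (fun y : Euc n => ‖y‖) z :=
        (contDiffAt_norm ℝ hz).differentiableAt one_ne_zero
      exact (hnd.inv hz').smul differentiableAt_fun_id
    have := jacMat_comp (V := fun y : Euc n => ‖y‖⁻¹ • y) (u := fun y => u y - a) (x := x) hd
      (hu.sub_const a)
    rw [hu', jacMat_normalize hz] at this
    exact this
  have hp : (fun j => proj n u a x j) = v := rfl
  rw [hj, hp, adjugate_mul_distrib, ← mulVec_mulVec, adjugate_smul, Matrix.smul_mulVec,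
    adj_proj v hvv, Fintype.card_fin]
  congr 1
  obtain ⟨m, rfl⟩ := Nat.exists_eq_succ_of_ne_zero hn
  ext j
  simp only [hv, kerK, Pi.smul_apply, PiLp.smul_apply, smul_eq_mul, Nat.succ_eq_add_one, Nat.add_sub_cancel,
    inv_pow]
  field_simp
  ring

lemma polar_integral {n : ℕ} (hn : n ≠ 0) (f : Euc n → ℝ) (hf : Integrable f) :
    ∫ x, f x = ∫ θ : sphere (0 : Euc n) 1, ∫ r in Set.Ioi (0:ℝ), r ^ (n - 1) * f (r • (θ : Euc n))
      ∂(volume : Measure ℝ) ∂((volume : Measure (Euc n)).toSphere) := by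
  have : Nonempty (Fin n) := Fin.pos_iff_nonempty.1 (Nat.pos_of_ne_zero hn)
  have : Nontrivial (Euc n) := inferInstance
  set μ : Measure (Euc n) := volume
  have hmp := μ.measurePreserving_homeomorphUnitSphereProd
  let F : sphere (0 : Euc n) 1 × Set.Ioi (0:ℝ) → ℝ := fun p => f (p.2.1 • p.1.1)
  have hFc : ∀ x : ({(0 : Euc n)}ᶜ : Set (Euc n)), F (homeomorphUnitSphereProd (Euc n) x) = f x.1 := by
    intro x
    have h := congrArg Subtype.val ((homeomorphUnitSphereProd (Euc n)).symm_apply_apply x)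
    rw [homeomorphUnitSphereProd_symm_apply_coe] at h
    exact congrArg f h
  have hemb : MeasurableEmbedding (homeomorphUnitSphereProd (Euc n)) :=
    Homeomorph.measurableEmbedding _
  have hIntg : Integrable F (μ.toSphere.prod (Measure.volumeIoiPow (Module.finrank ℝ (Euc n) - 1))) := by
    rw [← hmp.integrable_comp_emb hemb]
    have : F ∘ (homeomorphUnitSphereProd (Euc n)) = f ∘ Subtype.val := funext hFc
    rw [this, ← integrableOn_iff_comap_subtypeVal (measurableSet_singleton _).compl]
    exact hf.integrableOn
  have e1 : ∫ x, f x ∂μ = ∫ x : ({(0 : Euc n)}ᶜ : Set (Euc n)), f x.1 ∂(μ.comap (↑)) := by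
    rw [integral_subtype_comap (measurableSet_singleton _).compl f, restrict_compl_singleton]
  rw [e1]
  simp_rw [← hFc]
  rw [hmp.integral_comp hemb, integral_prod _ hIntg]
  refine integral_congr_ae (Eventually.of_forall fun θ => ?_)
  simp only [Measure.volumeIoiPow, ENNReal.ofReal, F]
  rw [integral_withDensity_eq_integral_smul ((measurable_subtype_coe.pow_const _).real_toNNReal),
    integral_subtype_comap measurableSet_Ioi
      (fun a : ℝ ↦ Real.toNNReal (a ^ (Module.finrank ℝ (Euc n) - 1)) • f (a • θ.1))]
  refine setIntegral_congr_fun measurableSet_Ioi fun x hx ↦ ?_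
  rw [NNReal.smul_def, Real.coe_toNNReal _ (pow_nonneg hx.out.le _)]
  simp

lemma integrable_fderiv_ker {n : ℕ} (hn : n ≠ 0) {g : Euc n → ℝ} (hg : ContDiff ℝ 1 g)
    (hgc : HasCompactSupport g) (y : Euc n) :
    Integrable (fun t => fderiv ℝ g (y - t) (kerK n t)) := by
  have hcs : HasCompactSupport (fderiv ℝ g) := hgc.fderiv ℝ
  have hc := hg.continuous_fderiv one_ne_zero
  have hcs' : HasCompactSupport (fun t => fderiv ℝ g (y - t)) :=
    hcs.comp_homeomorph (Homeomorph.subLeft y)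
  obtain ⟨M, hM⟩ := hcs.exists_bound_of_continuous hc
  obtain ⟨r, hr⟩ := hcs'.isCompact.isBounded.subset_ball (0 : Euc n)
  have hk := (kerK_integrableOn_ball hn r).norm.const_mul M
  have hmeas : AEStronglyMeasurable (fun t => fderiv ℝ g (y - t) (kerK n t)) volume := by
    have h1 : Measurable (fun t => fderiv ℝ g (y - t)) := by
      have : Continuous (fun t => fderiv ℝ g (y - t)) := by fun_prop
      exact this.measurable
    have h2 := (isBoundedBilinearMap_apply (𝕜 := ℝ) (E := Euc n) (F := ℝ)).continuous
    exact (h2.measurable.comp (h1.prodMk (kerK_measurable n))).aestronglyMeasurable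
  have : IntegrableOn (fun t => fderiv ℝ g (y - t) (kerK n t)) (ball 0 r) := by
    refine hk.mono' hmeas.restrict (Eventually.of_forall fun t => ?_)
    refine (ContinuousLinearMap.le_opNorm _ _).trans ?_
    exact mul_le_mul_of_nonneg_right (hM _) (norm_nonneg _)
  refine (integrableOn_iff_integrable_of_support_subset ?_).1 this
  intro t ht
  apply hr
  apply subset_tsupport
  intro h0
  apply ht
  simp only at h0
  simp [h0]

lemma integral_fderiv_ker {n : ℕ} (hn : n ≠ 0) {g : Euc n → ℝ} (hg : ContDiff ℝ 1 g)
    (hgc : HasCompactSupport g) (y : Euc n) :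
    ∫ t, fderiv ℝ g (y - t) (kerK n t) = n * ballVol n * g y := by
  rw [polar_integral hn _ (integrable_fderiv_ker hn hg hgc y)]
  have hin : ∀ θ : sphere (0 : Euc n) 1, ∫ r in Set.Ioi (0:ℝ), r ^ (n - 1) *
      fderiv ℝ g (y - r • (θ : Euc n)) (kerK n (r • (θ : Euc n))) = g y := by
    intro θ
    have hθ : ‖(θ : Euc n)‖ = 1 := by simp
    have h1 : ∀ r ∈ Set.Ioi (0:ℝ), r ^ (n - 1) *
      fderiv ℝ g (y - r • (θ : Euc n)) (kerK n (r • (θ : Euc n))) =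
        fderiv ℝ g (y - r • (θ : Euc n)) (θ : Euc n) := by
      intro r hr
      have hr0 : r ≠ 0 := (Set.mem_Ioi.1 hr).ne'
      rw [kerK, norm_smul, hθ, mul_one, Real.norm_of_nonneg (le_of_lt hr), map_smul, map_smul]
      obtain ⟨m, rfl⟩ := Nat.exists_eq_succ_of_ne_zero hn
      simp only [Nat.succ_eq_add_one, Nat.add_sub_cancel, smul_eq_mul]
      field_simp
      ring
    rw [setIntegral_congr_fun measurableSet_Ioi h1]
    have hc := hg.continuous_fderiv one_ne_zero
    have hder : ∀ r : ℝ, HasDerivAt (fun r : ℝ => - g (y - r • (θ : Euc n)))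
        (fderiv ℝ g (y - r • (θ : Euc n)) (θ : Euc n)) r := by
      intro r
      have h2 : HasDerivAt (fun r : ℝ => y - r • (θ : Euc n)) (-(θ : Euc n)) r := by
        simpa using ((hasDerivAt_id r).smul_const (θ : Euc n)).const_sub y
      have h3 := ((hg.differentiable one_ne_zero _).hasFDerivAt.comp_hasDerivAt r h2).neg
      have h4 : -(fderiv ℝ g (y - r • (θ : Euc n)) (-(θ : Euc n))) =
        fderiv ℝ g (y - r • (θ : Euc n)) (θ : Euc n) := by simp
      rw [h4] at h3
      exact h3
    obtain ⟨R, hR⟩ := hgc.isCompact.isBounded.subset_closedBall y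
    have hvan : ∀ r : ℝ, R < r → y - r • (θ : Euc n) ∉ tsupport g := by
      intro r hr hmem
      have := hR hmem
      rw [mem_closedBall, dist_eq_norm] at this
      simp [norm_smul, hθ] at this
      exact absurd (le_abs_self r) (by linarith)
    have hii : IntegrableOn (fun r : ℝ => fderiv ℝ g (y - r • (θ : Euc n)) (θ : Euc n)) (Set.Ioi 0) := by
      have hcont : Continuous (fun r : ℝ => fderiv ℝ g (y - r • (θ : Euc n)) (θ : Euc n)) := by
        fun_prop
      have h4 : IntegrableOn (fun r : ℝ => fderiv ℝ g (y - r • (θ : Euc n)) (θ : Euc n))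
          (Set.Icc 0 (max R 0)) := hcont.continuousOn.integrableOn_compact isCompact_Icc
      refine h4.of_forall_sdiff_eq_zero measurableSet_Ioi fun r hr => ?_
      have hr1 : max R 0 < r := by
        by_contra h5
        exact hr.2 ⟨le_of_lt hr.1, not_lt.1 h5⟩
      have h6 := hvan r (lt_of_le_of_lt (le_max_left _ _) hr1)
      have : fderiv ℝ g (y - r • (θ : Euc n)) = 0 := by
        by_contra h0
        exact h6 (support_fderiv_subset ℝ h0)
      simp [this]
    have hlim : Tendsto (fun r : ℝ => - g (y - r • (θ : Euc n))) atTop (𝓝 0) := by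
      refine tendsto_const_nhds.congr' ?_
      filter_upwards [eventually_gt_atTop R] with r hr
      rw [image_eq_zero_of_notMem_tsupport (hvan r hr), neg_zero]
    rw [integral_Ioi_of_hasDerivAt_of_tendsto (hder 0).continuousAt.continuousWithinAt
      (fun r _ => hder r) hii hlim]
    simp
  simp_rw [hin]
  rw [integral_const, Measure.toSphere_real_apply_univ]
  simp [ballVol, Measure.real]

open scoped Convolution in
/-- the Newtonian-type field `V(y) = ∫ g(a) K(y-a) da` -/
lemma exists_field {n : ℕ} (hn : n ≠ 0) {g : Euc n → ℝ} (hg : ContDiff ℝ 1 g)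
    (hgc : HasCompactSupport g) : ∃ V : Euc n → Euc n, ContDiff ℝ 1 V ∧
      (∀ y, Integrable fun a => g a • kerK n (y - a)) ∧
      (∀ y, V y = ∫ a, g a • kerK n (y - a)) ∧
      (∀ y, Matrix.trace (jacMat n V y) = n * ballVol n * g y) := by
  let L : Euc n →L[ℝ] ℝ →L[ℝ] Euc n := (ContinuousLinearMap.lsmul ℝ ℝ).flip
  have hloc := kerK_locallyIntegrable hn
  refine ⟨(kerK n) ⋆[L, volume] g, ?_, ?_, ?_, ?_⟩
  · exact hgc.contDiff_convolution_right L hloc hg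
  · intro y
    have hex : ConvolutionExistsAt (kerK n) g y L volume :=
      hgc.convolutionExists_right _ hloc hg.continuous y
    have := Integrable.comp_sub_left hex y
    simpa [L] using this
  · intro y
    rw [convolution_def, ← integral_sub_left_eq_self _ volume y]
    simp [L]
  · intro y
    have hfd := (hgc.hasFDerivAt_convolution_right L hloc hg y).fderiv
    have hex : ConvolutionExistsAt (kerK n) (fderiv ℝ g) y (L.precompR (Euc n)) volume :=
      (hgc.fderiv ℝ).convolutionExists_right _ hloc (hg.continuous_fderiv one_ne_zero) y
    let Tr : (Euc n →L[ℝ] Euc n) →L[ℝ] ℝ := ∑ i : Fin n,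
      (EuclideanSpace.proj i : Euc n →L[ℝ] ℝ).comp
        (ContinuousLinearMap.apply ℝ (Euc n) (EuclideanSpace.single i (1:ℝ)))
    have hTr : ∀ A : Euc n →L[ℝ] Euc n, Tr A = ∑ i, A (EuclideanSpace.single i 1) i := by
      intro A
      simp [Tr]
    have h1 : Matrix.trace (jacMat n ((kerK n) ⋆[L, volume] g) y) =
        Tr (fderiv ℝ ((kerK n) ⋆[L, volume] g) y) := by
      rw [hTr]; rfl
    rw [h1, hfd, convolution_def, ← ContinuousLinearMap.integral_comp_comm _ hex,
      ← integral_fderiv_ker hn hg hgc y]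
    refine integral_congr_ae (Eventually.of_forall fun t => ?_)
    simp only [hTr]
    have h2 : ∀ i, ((L.precompR (Euc n)) (kerK n t) (fderiv ℝ g (y - t))) (EuclideanSpace.single i 1) i
       = fderiv ℝ g (y - t) (EuclideanSpace.single i 1) * kerK n t i := by
      intro i
      simp [L, ContinuousLinearMap.precompR_apply]
    simp_rw [h2]
    have h3 : kerK n t = ∑ i, kerK n t i • EuclideanSpace.single i (1:ℝ) := by
      have := (EuclideanSpace.basisFun (Fin n) ℝ).sum_repr (kerK n t)
      simpa using this.symm
    conv_rhs => rw [h3, map_sum]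
    refine Finset.sum_congr rfl fun i _ => ?_
    rw [map_smul, smul_eq_mul, mul_comm]

/-- The pairing of the kernel centred at `a` with the vector field `bvec`. -/
def pairI (n : ℕ) (u : Euc n → Euc n) (ψ : Euc n → ℝ) (a x : Euc n) : ℝ :=
  inner ℝ (bvec n u ψ x) (kerK n (u x - a))

lemma pairI_prod_integrable {n : ℕ} (hn : n ≠ 0) {u : Euc n → Euc n} (hu : ContDiff ℝ 1 u)
    (huc : HasCompactSupport u) {ψ : Euc n → ℝ} (hψ : ContDiff ℝ 1 ψ) (hψc : HasCompactSupport ψ)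
    {φ : Euc n → ℝ} (hφ : Measurable φ) {B R : ℝ} (hB : ∀ a, |φ a| ≤ B)
    (hR : ∀ a, a ∉ ball (0 : Euc n) R → φ a = 0) :
    Integrable (fun q : Euc n × Euc n => φ q.2 * pairI n u ψ q.2 q.1) (volume.prod volume) := by
  have hB0 : 0 ≤ B := (abs_nonneg _).trans (hB 0)
  obtain ⟨M, hM⟩ : ∃ M, ∀ x, ‖u x‖ ≤ M := huc.exists_bound_of_continuous hu.continuous
  have hbc := bvec_continuous hu hψ
  set k1 : Euc n → ℝ := (ball (0 : Euc n) (M + R)).indicator (fun z => ‖kerK n z‖) with hk1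
  have hk1i : Integrable k1 :=
    (integrable_indicator_iff measurableSet_ball).2 (kerK_integrableOn_ball hn (M + R)).norm
  have hk1m : Measurable k1 := (kerK_measurable n).norm.indicator measurableSet_ball
  have hk10 : ∀ z, 0 ≤ k1 z := fun z => Set.indicator_nonneg (fun _ _ => norm_nonneg _) z
  have hum := hu.continuous.measurable
  have hdom : Integrable (fun q : Euc n × Euc n => B * ‖bvec n u ψ q.1‖ * k1 (u q.1 - q.2))
      (volume.prod volume) := by
    have hmeas : Measurable (fun q : Euc n × Euc n => B * ‖bvec n u ψ q.1‖ * k1 (u q.1 - q.2)) := by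
      refine ((hbc.measurable.comp measurable_fst).norm.const_mul B).mul ?_
      exact hk1m.comp ((hum.comp measurable_fst).sub measurable_snd)
    rw [integrable_prod_iff hmeas.aestronglyMeasurable]
    constructor
    · refine Eventually.of_forall fun x => ?_
      exact (hk1i.comp_sub_left (u x)).const_mul (B * ‖bvec n u ψ x‖)
    · have h1 : (fun x => ∫ y, ‖B * ‖bvec n u ψ x‖ * k1 (u x - y)‖) =
          fun x => ‖bvec n u ψ x‖ * (B * ∫ z, k1 z) := by
        funext x
        have : ∀ y, ‖B * ‖bvec n u ψ x‖ * k1 (u x - y)‖ = (B * ‖bvec n u ψ x‖) * k1 (u x - y) := by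
          intro y
          rw [Real.norm_of_nonneg]
          exact mul_nonneg (mul_nonneg hB0 (norm_nonneg _)) (hk10 _)
        simp_rw [this]
        rw [integral_const_mul, integral_sub_left_eq_self (fun z => k1 z)]
        ring
      show Integrable (fun x => ∫ y, ‖B * ‖bvec n u ψ x‖ * k1 (u x - y)‖) volume
      rw [h1]
      refine Integrable.mul_const ?_ _
      refine hbc.norm.integrable_of_hasCompactSupport ?_
      refine HasCompactSupport.intro hψc.isCompact fun x hx => ?_
      rw [bvec_eq_zero hx, norm_zero]
  refine hdom.mono' ?_ ?_
  · refine Measurable.aestronglyMeasurable ?_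
    refine (hφ.comp measurable_snd).mul ?_
    exact (hbc.measurable.comp measurable_fst).inner
      ((kerK_measurable n).comp ((hum.comp measurable_fst).sub measurable_snd))
  · refine Eventually.of_forall fun q => ?_
    by_cases hq : q.2 ∈ ball (0 : Euc n) R
    · have hz : u q.1 - q.2 ∈ ball (0 : Euc n) (M + R) := by
        rw [mem_ball_zero_iff] at hq ⊢
        exact (norm_sub_le _ _).trans_lt (add_lt_add_of_le_of_lt (hM _) hq)
      have : k1 (u q.1 - q.2) = ‖kerK n (u q.1 - q.2)‖ := Set.indicator_of_mem hz _
      rw [norm_mul, this, mul_assoc]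
      refine mul_le_mul (hB _) (norm_inner_le_norm _ _) (norm_nonneg _) hB0
    · rw [hR _ hq, zero_mul, norm_zero]
      exact mul_nonneg (mul_nonneg hB0 (norm_nonneg _)) (hk10 _)

lemma pairI_ae_integrable {n : ℕ} (hn : n ≠ 0) {u : Euc n → Euc n} (hu : ContDiff ℝ 1 u)
    (huc : HasCompactSupport u) {ψ : Euc n → ℝ} (hψ : ContDiff ℝ 1 ψ) (hψc : HasCompactSupport ψ) :
    ∀ᵐ a : Euc n, Integrable (fun x => pairI n u ψ a x) := by
  have h : ∀ k : ℕ, ∀ᵐ a : Euc n, Integrable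
      (fun x => (ball (0 : Euc n) k).indicator (fun _ => (1 : ℝ)) a * pairI n u ψ a x) := by
    intro k
    have := pairI_prod_integrable hn hu huc hψ hψc
      (φ := (ball (0 : Euc n) k).indicator (fun _ => (1 : ℝ))) (B := 1) (R := k)
      (measurable_const.indicator measurableSet_ball)
      (fun a => by by_cases ha : a ∈ ball (0 : Euc n) k <;> simp [Set.indicator, ha])
      (fun a ha => Set.indicator_of_notMem ha _)
    exact this.prod_left_ae
  filter_upwards [ae_all_iff.2 h] with a ha
  obtain ⟨k, hk⟩ := exists_nat_gt ‖a‖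
  have := ha k
  rw [Set.indicator_of_mem (by simpa using hk)] at this
  simpa using this

lemma pairI_integral_integrable {n : ℕ} (hn : n ≠ 0) {u : Euc n → Euc n} (hu : ContDiff ℝ 1 u)
    (huc : HasCompactSupport u) {ψ : Euc n → ℝ} (hψ : ContDiff ℝ 1 ψ) (hψc : HasCompactSupport ψ)
    {φ : Euc n → ℝ} (hφ : Measurable φ) {B R : ℝ} (hB : ∀ a, |φ a| ≤ B)
    (hR : ∀ a, a ∉ ball (0 : Euc n) R → φ a = 0) :
    Integrable (fun a => φ a * ∫ x, pairI n u ψ a x) := by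
  have := (pairI_prod_integrable hn hu huc hψ hψc hφ hB hR).integral_prod_right
  simpa [integral_const_mul] using this

lemma pairI_integrableOn_ball {n : ℕ} (hn : n ≠ 0) {u : Euc n → Euc n} (hu : ContDiff ℝ 1 u)
    (huc : HasCompactSupport u) {ψ : Euc n → ℝ} (hψ : ContDiff ℝ 1 ψ) (hψc : HasCompactSupport ψ)
    (R : ℝ) : IntegrableOn (fun a => ∫ x, pairI n u ψ a x) (ball 0 R) := by
  have := pairI_integral_integrable hn hu huc hψ hψc
      (φ := (ball (0 : Euc n) R).indicator (fun _ => (1 : ℝ))) (B := 1) (R := R)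
      (measurable_const.indicator measurableSet_ball)
      (fun a => by by_cases ha : a ∈ ball (0 : Euc n) R <;> simp [Set.indicator, ha])
      (fun a ha => Set.indicator_of_notMem ha _)
  rw [← integrable_indicator_iff measurableSet_ball]
  refine this.congr (Eventually.of_forall fun a => ?_)
  by_cases ha : a ∈ ball (0 : Euc n) R <;> simp [Set.indicator, ha]

lemma pairI_integral_smooth {n : ℕ} (hn : n ≠ 0) {u : Euc n → Euc n} (hu : ContDiff ℝ 1 u)
    (huc : HasCompactSupport u) {ψ : Euc n → ℝ} (hψ : ContDiff ℝ 1 ψ) (hψc : HasCompactSupport ψ)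
    {g : Euc n → ℝ} (hg : ContDiff ℝ 1 g) (hgc : HasCompactSupport g) :
    ∫ a, g a * ∫ x, pairI n u ψ a x =
      -(n * ballVol n) * ∫ x, ψ x * g (u x) * (jacMat n u x).det := by
  obtain ⟨V, hV, hVi, hVe, hVt⟩ := exists_field hn hg hgc
  obtain ⟨B, hB⟩ := hgc.exists_bound_of_continuous hg.continuous
  obtain ⟨R, hR⟩ := hgc.isCompact.isBounded.subset_ball (0 : Euc n)
  have hIntg := pairI_prod_integrable hn hu huc hψ hψc hg.continuous.measurable hB
    (R := R) (fun a ha => image_eq_zero_of_notMem_tsupport fun h => ha (hR h))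
  have h1 : ∫ x, ∫ a, g a * pairI n u ψ a x = ∫ a, ∫ x, g a * pairI n u ψ a x :=
    integral_integral_swap hIntg
  simp_rw [← integral_const_mul (g _)]
  rw [← h1]
  have h2 : ∀ x, ∫ a, g a * pairI n u ψ a x = inner ℝ (bvec n u ψ x) (V (u x)) := by
    intro x
    rw [hVe, ← integral_inner (hVi (u x))]
    simp [pairI, inner_smul_right]
  simp_rw [h2]
  rw [key_identity hn hu huc hψ hψc hV, ← integral_const_mul, ← integral_neg]
  refine integral_congr_ae (Eventually.of_forall fun x => ?_)
  simp only [hVt]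
  ring

lemma pairI_ae_zero {n : ℕ} (hn : n ≠ 0) {u : Euc n → Euc n} (hu : ContDiff ℝ 1 u)
    (huc : HasCompactSupport u) {ψ : Euc n → ℝ} (hψ : ContDiff ℝ 1 ψ) (hψc : HasCompactSupport ψ) :
    ∀ᵐ a : Euc n, a ∈ (u '' tsupport ψ)ᶜ → ∫ x, pairI n u ψ a x = 0 := by
  have hQ : IsClosed (u '' tsupport ψ) := (hψc.isCompact.image hu.continuous).isClosed
  refine hQ.isOpen_compl.ae_eq_zero_of_integral_contDiff_smul_eq_zero ?_ ?_
  · refine LocallyIntegrable.locallyIntegrableOn ?_ _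
    intro a
    refine ⟨ball 0 (‖a‖ + 1), isOpen_ball.mem_nhds (by simp), ?_⟩
    exact pairI_integrableOn_ball hn hu huc hψ hψc _
  · intro g hg hgc hgs
    simp_rw [smul_eq_mul]
    rw [pairI_integral_smooth hn hu huc hψ hψc (hg.of_le (by exact_mod_cast le_top)) hgc]
    have : ∀ x, ψ x * g (u x) * (jacMat n u x).det = 0 := by
      intro x
      by_cases hx : x ∈ tsupport ψ
      · have : u x ∉ tsupport g := fun h => hgs h ⟨x, hx, rfl⟩
        rw [image_eq_zero_of_notMem_tsupport this]; ring
      · rw [image_eq_zero_of_notMem_tsupport hx]; ring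
    simp [this]

lemma pairI_integrable {n : ℕ} (hn : n ≠ 0) {u : Euc n → Euc n} (hu : ContDiff ℝ 1 u)
    (huc : HasCompactSupport u) {ψ : Euc n → ℝ} (hψ : ContDiff ℝ 1 ψ) (hψc : HasCompactSupport ψ) :
    Integrable (fun a => ∫ x, pairI n u ψ a x) := by
  obtain ⟨R, hR⟩ := (hψc.isCompact.image hu.continuous).isBounded.subset_ball (0 : Euc n)
  have h := (integrable_indicator_iff measurableSet_ball).2
    (pairI_integrableOn_ball hn hu huc hψ hψc R)
  refine h.congr ?_
  filter_upwards [pairI_ae_zero hn hu huc hψ hψc] with a ha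
  by_cases haR : a ∈ ball (0 : Euc n) R
  · rw [Set.indicator_of_mem haR]
  · rw [Set.indicator_of_notMem haR, ha fun h => haR (hR h)]

lemma pairI_chain {n : ℕ} (hn : n ≠ 0) {u : Euc n → Euc n} (hu : ContDiff ℝ 1 u)
    (huc : HasCompactSupport u) {ψ : Euc n → ℝ} (hψ : ContDiff ℝ 1 ψ) (hψc : HasCompactSupport ψ)
    {G : Euc n → ℝ} (hG : Continuous G) :
    Integrable (fun a => G a * ∫ x, pairI n u ψ a x) ∧
    ∫ a, G a * ∫ x, pairI n u ψ a x =
      -(n * ballVol n) * ∫ x, ψ x * G (u x) * (jacMat n u x).det := by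
  set h : Euc n → ℝ := fun a => ∫ x, pairI n u ψ a x with hh
  have hi : Integrable h := pairI_integrable hn hu huc hψ hψc
  have hQ := hψc.isCompact.image hu.continuous
  obtain ⟨χ, hχ1, -, hχc, hχ01⟩ := exists_continuous_one_zero_of_isCompact hQ isClosed_empty
    (Set.disjoint_empty _)
  set Gt : Euc n → ℝ := fun a => χ a * G a with hGt
  have hGtc : Continuous Gt := χ.continuous.mul hG
  have hGts : HasCompactSupport Gt := hχc.mul_right
  have hae : ∀ᵐ a, Gt a * h a = G a * h a := by
    filter_upwards [pairI_ae_zero hn hu huc hψ hψc] with a ha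
    by_cases haQ : a ∈ u '' tsupport ψ
    · simp [hGt, hχ1 haQ]
    · have : h a = 0 := ha haQ
      rw [this]; simp
  have heq : ∀ x, ψ x * G (u x) * (jacMat n u x).det = ψ x * Gt (u x) * (jacMat n u x).det := by
    intro x
    by_cases hx : x ∈ tsupport ψ
    · have := hχ1 (Set.mem_image_of_mem u hx)
      simp [hGt, this]
    · rw [image_eq_zero_of_notMem_tsupport hx]; ring
  simp_rw [heq]
  rw [← integral_congr_ae hae]
  have hbdd : ∀ f : Euc n → ℝ, Continuous f → HasCompactSupport f →
      Integrable (fun a => f a * h a) := by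
    intro f hf hfc
    obtain ⟨B, hB⟩ := hfc.exists_bound_of_continuous hf
    exact hi.bdd_mul hf.aestronglyMeasurable (Eventually.of_forall hB)
  refine ⟨(hbdd Gt hGtc hGts).congr hae, ?_⟩
  have hdetc : Continuous fun x => (jacMat n u x).det := (jacMat_continuous hu).matrix_det
  have hIntg2 : ∀ f : Euc n → ℝ, Continuous f →
      Integrable (fun x => ψ x * f (u x) * (jacMat n u x).det) := by
    intro f hf
    refine Continuous.integrable_of_hasCompactSupport
      ((hψ.continuous.mul (hf.comp hu.continuous)).mul hdetc) ?_
    exact (hψc.mul_right).mul_right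
  have hψd : Integrable (fun x => ψ x * (jacMat n u x).det) := by
    simpa using hIntg2 (fun _ => 1) continuous_const
  set C : ℝ := (∫ a, |h a|) + |n * ballVol n| * ∫ x, |ψ x * (jacMat n u x).det| with hC
  have hC0 : 0 ≤ C := by positivity
  have hbound : ∀ ε > 0, |(∫ a, Gt a * h a) -
      -(n * ballVol n) * ∫ x, ψ x * Gt (u x) * (jacMat n u x).det| ≤ ε * C := by
    intro ε hε
    obtain ⟨g, hg, hgd, hgs⟩ := hGtc.exists_contDiff_approx 1 (ε := fun _ => ε)
      continuous_const (fun _ => hε)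
    have hgc : HasCompactSupport g := hGts.mono hgs
    have hg1 : ContDiff ℝ 1 g := by simpa using hg
    have e := pairI_integral_smooth hn hu huc hψ hψc hg1 hgc
    have e1 : (∫ a, Gt a * h a) - ∫ a, g a * h a = ∫ a, (Gt a - g a) * h a := by
      rw [← integral_sub (hbdd Gt hGtc hGts) (hbdd g hg1.continuous hgc)]
      simp_rw [sub_mul]
    have e2 : (∫ x, ψ x * g (u x) * (jacMat n u x).det) -
        ∫ x, ψ x * Gt (u x) * (jacMat n u x).det =
        ∫ x, (g (u x) - Gt (u x)) * (ψ x * (jacMat n u x).det) := by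
      rw [← integral_sub (hIntg2 g hg1.continuous) (hIntg2 Gt hGtc)]
      refine integral_congr_ae (Eventually.of_forall fun x => ?_)
      simp only
      ring
    have b1 : |∫ a, (Gt a - g a) * h a| ≤ ε * ∫ a, |h a| := by
      rw [← integral_const_mul, ← Real.norm_eq_abs]
      refine norm_integral_le_of_norm_le (hi.abs.const_mul ε) (Eventually.of_forall fun a => ?_)
      rw [norm_mul, Real.norm_eq_abs (h a)]
      refine mul_le_mul_of_nonneg_right ?_ (abs_nonneg _)
      have := (hgd a).le
      rwa [dist_comm, dist_eq_norm] at this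
    have b2 : |∫ x, (g (u x) - Gt (u x)) * (ψ x * (jacMat n u x).det)| ≤
        ε * ∫ x, |ψ x * (jacMat n u x).det| := by
      rw [← integral_const_mul, ← Real.norm_eq_abs]
      refine norm_integral_le_of_norm_le (hψd.abs.const_mul ε) (Eventually.of_forall fun x => ?_)
      rw [norm_mul, Real.norm_eq_abs (ψ x * _)]
      refine mul_le_mul_of_nonneg_right ?_ (abs_nonneg _)
      have := (hgd (u x)).le
      rwa [dist_eq_norm] at this
    have e3 : (∫ a, Gt a * h a) - -(n * ballVol n) * ∫ x, ψ x * Gt (u x) * (jacMat n u x).det =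
        (∫ a, (Gt a - g a) * h a) -
        (n * ballVol n) * ∫ x, (g (u x) - Gt (u x)) * (ψ x * (jacMat n u x).det) := by
      have e' : ∫ a, g a * h a = -(n * ballVol n) * ∫ x, ψ x * g (u x) * (jacMat n u x).det := e
      rw [← e1, ← e2, e']
      ring
    rw [e3]
    refine (abs_sub _ _).trans ?_
    rw [abs_mul, hC]
    have := mul_le_mul_of_nonneg_left b2 (abs_nonneg ((n:ℝ) * ballVol n))
    linarith
  have hle : |(∫ a, Gt a * h a) -
      -(n * ballVol n) * ∫ x, ψ x * Gt (u x) * (jacMat n u x).det| ≤ 0 := by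
    refine le_of_forall_pos_le_add fun δ hδ => ?_
    have h1 := hbound (δ / (C + 1)) (by positivity)
    refine h1.trans ?_
    rw [zero_add, div_mul_eq_mul_div, div_le_iff₀ (by positivity)]
    nlinarith
  exact sub_eq_zero.1 (abs_nonpos_iff.1 hle)

lemma exists_global_ext {n : ℕ} {Ω : Set (Euc n)} (hΩo : IsOpen Ω) {u : Euc n → Euc n}
    (hu : ContDiffOn ℝ 1 u Ω) {K : Set (Euc n)} (hK : IsCompact K) (hKΩ : K ⊆ Ω) :
    ∃ U : Euc n → Euc n, ContDiff ℝ 1 U ∧ HasCompactSupport U ∧ ∀ x ∈ K, U =ᶠ[𝓝 x] u := by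
  obtain ⟨L, hL, hKL, hLΩ⟩ := exists_compact_between hK hΩo hKΩ
  obtain ⟨f, hf1, hf0, -⟩ := exists_contMDiffMap_one_nhds_of_subset_interior
    (n := 1) (modelWithCornersSelf ℝ (Euc n)) hK.isClosed hKL
  have hfs : ContDiff ℝ 1 f := f.contMDiff.contDiff
  have hsupp : ∀ x, x ∉ L → f x • u x = 0 := fun x hx => by rw [hf0 x hx, zero_smul]
  refine ⟨fun x => f x • u x, ?_, HasCompactSupport.intro hL hsupp, ?_⟩
  · rw [contDiff_iff_contDiffAt]
    intro x
    by_cases hx : x ∈ Ω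
    · exact hfs.contDiffAt.smul (hu.contDiffAt (hΩo.mem_nhds hx))
    · have hx' : Lᶜ ∈ 𝓝 x := hL.isClosed.isOpen_compl.mem_nhds fun h => hx (hLΩ h)
      refine (contDiffAt_const (c := (0 : Euc n))).congr_of_eventuallyEq ?_
      filter_upwards [hx'] with y hy
      exact hsupp y hy
  · intro x hx
    have := (eventually_nhdsSet_iff_forall.1 hf1) x hx
    filter_upwards [this] with y hy
    rw [hy, one_smul]

lemma jacMat_congr {n : ℕ} {U u : Euc n → Euc n} {x : Euc n} (h : U =ᶠ[𝓝 x] u) :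
    jacMat n U x = jacMat n u x := by
  unfold jacMat
  rw [h.fderiv_eq]

lemma ballVol_pos (n : ℕ) : 0 < ballVol n :=
  ENNReal.toReal_pos (measure_ball_pos _ _ one_pos).ne' measure_ball_lt_top.ne

end Aux

/-- (Weak chain rule for smooth maps.) -/
theorem weak_chain_rule_smooth
    (n : ℕ) (hn : 2 ≤ n) (Ω : Set (Euc n)) (hΩo : IsOpen Ω)
    (hΩb : Bornology.IsBounded Ω) (hΩs : SmoothBoundary n Ω)
    (u : Euc n → Euc n) (hu : ContDiffOn ℝ 1 u (closure Ω))
    (F : Euc n → Euc n) (hF : ContDiff ℝ 1 F)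
    (ψ : Euc n → ℝ) (hψ : Cc1 n Ω ψ) :
    (∀ᵐ a : Euc n, IntegrableOn (fun x => jPair n (proj n u a) ψ x) Ω) ∧
    Integrable
      (fun a : Euc n => (jacMat n F a).det * -∫ x in Ω, jPair n (proj n u a) ψ x) volume ∧
    ∫ x in Ω, ψ x * (jacMat n F (u x)).det * (jacMat n u x).det =
      (ballVol n)⁻¹ *
        ∫ a : Euc n, (jacMat n F a).det * -∫ x in Ω, jPair n (proj n u a) ψ x := by
  have hn0 : n ≠ 0 := by omega
  obtain ⟨hψ1, hψc, hψs⟩ := hψ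
  have huΩ : ContDiffOn ℝ 1 u Ω := hu.mono subset_closure
  obtain ⟨U, hU, hUc, hUu⟩ := exists_global_ext hΩo huΩ hψc.isCompact hψs
  have hpair : ∀ a x, x ∈ Ω → jPair n (proj n u a) ψ x = (n : ℝ)⁻¹ * pairI n U ψ a x := by
    intro a x hx
    have hd : DifferentiableAt ℝ u x :=
      (huΩ.contDiffAt (hΩo.mem_nhds hx)).differentiableAt one_ne_zero
    rw [jPair_proj hn0 hd, pairI]
    by_cases hxs : x ∈ tsupport ψ
    · have h := hUu x hxs
      rw [bvec, bvec, jacMat_congr h, h.eq_of_nhds]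
    · rw [bvec_eq_zero hxs, bvec_eq_zero hxs, inner_zero_left, inner_zero_left]
  have hpair0 : ∀ a x, x ∉ Ω → pairI n U ψ a x = 0 := by
    intro a x hx
    rw [pairI, bvec_eq_zero fun h => hx (hψs h), inner_zero_left]
  have hintg : ∀ a, ∫ x in Ω, jPair n (proj n u a) ψ x = (n : ℝ)⁻¹ * ∫ x, pairI n U ψ a x := by
    intro a
    rw [setIntegral_congr_fun hΩo.measurableSet (fun x hx => hpair a x hx), integral_const_mul,
      setIntegral_eq_integral_of_forall_compl_eq_zero (hpair0 a)]
  have hGc : Continuous fun a => (jacMat n F a).det := (jacMat_continuous hF).matrix_det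
  obtain ⟨hI, hE⟩ := pairI_chain hn0 hU hUc hψ1 hψc hGc
  have hfun : (fun a : Euc n => (jacMat n F a).det * -∫ x in Ω, jPair n (proj n u a) ψ x) =
      fun a => -(n : ℝ)⁻¹ * ((jacMat n F a).det * ∫ x, pairI n U ψ a x) := by
    funext a
    rw [hintg]
    ring
  refine ⟨?_, ?_, ?_⟩
  · filter_upwards [pairI_ae_integrable hn0 hU hUc hψ1 hψc] with a ha
    refine IntegrableOn.congr_fun ((ha.const_mul (n : ℝ)⁻¹).integrableOn)
      (fun x hx => (hpair a x hx).symm) hΩo.measurableSet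
  · rw [hfun]
    exact hI.const_mul _
  · rw [hfun, integral_const_mul, hE]
    have hL : ∫ x in Ω, ψ x * (jacMat n F (u x)).det * (jacMat n u x).det =
        ∫ x, ψ x * (jacMat n F (U x)).det * (jacMat n U x).det := by
      refine Eq.trans ?_ (setIntegral_eq_integral_of_forall_compl_eq_zero (s := Ω) ?_)
      · refine setIntegral_congr_fun hΩo.measurableSet fun x _ => ?_
        by_cases hxs : x ∈ tsupport ψ
        · have h := hUu x hxs
          rw [jacMat_congr h, h.eq_of_nhds]
        · rw [image_eq_zero_of_notMem_tsupport hxs]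
          ring
      · intro x hx
        rw [image_eq_zero_of_notMem_tsupport fun h => hx (hψs h)]
        ring
    rw [hL]
    have h1 := (ballVol_pos n).ne'
    have h2 : (n : ℝ) ≠ 0 := by exact_mod_cast hn0
    field_simp

end
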